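/- Theorem 1 (convergence of EXP-D-RL in hypo-monotone games): let γ > 0, μ > 0, ε > μ, consider N players with action counts n^p, n = Σ_p n^p, strategy space Δ = Π_p Δ^{n^p} ⊂ ℝⁿ, blockwise soft-max σ : ℝⁿ → ℝⁿ, and a Lipschitz continuous payoff map U : Δ → ℝⁿ such that −U is μ-hypo-monotone on Δ, i.e., (x − x')ᵀ(U(x) − U(x')) ≤ μ‖x − x'‖₂² for all x, x' ∈ Δ. Assume the set {z ∈ ℝⁿ : z = U(σ(z))} is finite. Then for every differentiable solution z : [0, ∞) → ℝⁿ of ż(t) = γ(U(σ(z(t))) − z(t)), there exists a fixed point z̄* = U(σ(z̄*)) such that z(t) → z̄* as t → ∞, and σ(z(t)) → σ(z̄*) as t → ∞. -/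

import Mathlib

open Filter

/-- The soft-max function with temperature `ε`. -/
noncomputable def softmax (ε : ℝ) {m : ℕ} (w : Fin m → ℝ) : Fin m → ℝ :=
  fun i => Real.exp (w i / ε) / ∑ j, Real.exp (w j / ε)

/-- The blockwise soft-max `σ(z) = (σ_ε(z^p))_p`. -/
noncomputable def softmaxBlk (ε : ℝ) {N : ℕ} {nAct : Fin N → ℕ}
    (z : ∀ p, Fin (nAct p) → ℝ) : ∀ p, Fin (nAct p) → ℝ :=
  fun p => softmax ε (z p)

/-- The strategy space `Δ = Π_p Δ^{n^p}`. -/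
def simplexProd (N : ℕ) (nAct : Fin N → ℕ) : Set (∀ p, Fin (nAct p) → ℝ) :=
  {x | ∀ p, (∀ i, 0 ≤ x p i) ∧ ∑ i, x p i = 1}

lemma smx_sum_pos {m : ℕ} (hm : 0 < m) (ε : ℝ) (w : Fin m → ℝ) :
    0 < ∑ j, Real.exp (w j / ε) := by
  have : Nonempty (Fin m) := ⟨⟨0, hm⟩⟩
  exact Finset.sum_pos (fun _ _ => Real.exp_pos _) Finset.univ_nonempty

lemma smx_pos {m : ℕ} (hm : 0 < m) (ε : ℝ) (w : Fin m → ℝ) (i : Fin m) :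
    0 < softmax ε w i := div_pos (Real.exp_pos _) (smx_sum_pos hm ε w)

lemma smx_sum {m : ℕ} (hm : 0 < m) (ε : ℝ) (w : Fin m → ℝ) :
    ∑ i, softmax ε w i = 1 := by
  unfold softmax
  rw [← Finset.sum_div]
  exact div_self (smx_sum_pos hm ε w).ne'

lemma smx_le_one {m : ℕ} (hm : 0 < m) (ε : ℝ) (w : Fin m → ℝ) (i : Fin m) :
    softmax ε w i ≤ 1 := by
  rw [← smx_sum hm ε w]
  exact Finset.single_le_sum (f := fun i => softmax ε w i)
    (fun j _ => (smx_pos hm ε w j).le) (Finset.mem_univ i)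

noncomputable def lseF (ε : ℝ) {m : ℕ} (w : Fin m → ℝ) : ℝ :=
  Real.log (∑ j, Real.exp (w j / ε))

lemma smx_log {m : ℕ} (hm : 0 < m) (ε : ℝ) (w : Fin m → ℝ) (i : Fin m) :
    Real.log (softmax ε w i) = w i / ε - lseF ε w := by
  unfold softmax lseF
  rw [Real.log_div (Real.exp_pos _).ne' (smx_sum_pos hm ε w).ne', Real.log_exp]

lemma log_aux {a b : ℝ} (ha : 0 < a) (hb : 0 < b) :
    a - b ≤ a * (Real.log a - Real.log b) := by
  have h := Real.log_le_sub_one_of_pos (div_pos hb ha)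
  rw [Real.log_div hb.ne' ha.ne'] at h
  have h2 := mul_le_mul_of_nonneg_left h ha.le
  have h3 : a * (b / a - 1) = b - a := by field_simp
  nlinarith

lemma log_coco {a b : ℝ} (ha : 0 < a) (hb : 0 < b) (ha1 : a ≤ 1) (hb1 : b ≤ 1) :
    (a - b) ^ 2 ≤ (a - b) * (Real.log a - Real.log b) := by
  wlog hab : b ≤ a generalizing a b
  · have := this hb ha hb1 ha1 (le_of_not_ge hab)
    nlinarith
  have h := log_aux ha hb
  have h0 : Real.log b ≤ Real.log a := Real.log_le_log hb hab
  have : a - b ≤ Real.log a - Real.log b := by nlinarith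
  nlinarith

lemma smx_coco {m : ℕ} (hm : 0 < m) {ε : ℝ} (hε : 0 < ε) (w w' : Fin m → ℝ) :
    ε * ∑ i, (softmax ε w i - softmax ε w' i) ^ 2 ≤
      ∑ i, (softmax ε w i - softmax ε w' i) * (w i - w' i) := by
  have h1 : ∑ i, (softmax ε w i - softmax ε w' i) * (w i - w' i) =
      ∑ i, ε * ((softmax ε w i - softmax ε w' i) *
        (Real.log (softmax ε w i) - Real.log (softmax ε w' i))) := by
    have h2 : ∑ i, (softmax ε w i - softmax ε w' i) * (ε * (lseF ε w - lseF ε w')) = 0 := by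
      rw [← Finset.sum_mul, Finset.sum_sub_distrib, smx_sum hm, smx_sum hm]; simp
    rw [← sub_eq_zero, ← Finset.sum_sub_distrib, ← h2]
    refine Finset.sum_congr rfl fun i _ => ?_
    rw [smx_log hm, smx_log hm]
    field_simp
    ring
  rw [h1, Finset.mul_sum]
  refine Finset.sum_le_sum fun i _ => mul_le_mul_of_nonneg_left ?_ hε.le
  exact log_coco (smx_pos hm _ _ _) (smx_pos hm _ _ _) (smx_le_one hm _ _ _) (smx_le_one hm _ _ _)

lemma lse_conv {m : ℕ} (hm : 0 < m) {ε : ℝ} (hε : 0 < ε) (w w' : Fin m → ℝ) :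
    ε * lseF ε w - ε * lseF ε w' ≤ ∑ i, softmax ε w i * (w i - w' i) := by
  have h : ∑ i, (softmax ε w i - softmax ε w' i) ≤
      ∑ i, softmax ε w i * (Real.log (softmax ε w i) - Real.log (softmax ε w' i)) :=
    Finset.sum_le_sum fun i _ => log_aux (smx_pos hm _ _ _) (smx_pos hm _ _ _)
  rw [Finset.sum_sub_distrib, smx_sum hm, smx_sum hm, sub_self] at h
  have h1 : ε * ∑ i, softmax ε w i * (Real.log (softmax ε w i) - Real.log (softmax ε w' i))
      = ∑ i, softmax ε w i * (w i - w' i) - (∑ i, softmax ε w i) * (ε * lseF ε w - ε * lseF ε w') := by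
    rw [Finset.mul_sum, Finset.sum_mul, ← Finset.sum_sub_distrib]
    refine Finset.sum_congr rfl fun i _ => ?_
    rw [smx_log hm, smx_log hm]
    field_simp
    ring
  rw [smx_sum hm] at h1
  have := mul_nonneg hε.le h
  linarith

lemma lse_deriv {m : ℕ} (hm : 0 < m) {ε : ℝ} (hε : 0 < ε) (w : ℝ → Fin m → ℝ) (w' : Fin m → ℝ)
    (t : ℝ) (h : ∀ i, HasDerivAt (fun s => w s i) (w' i) t) :
    HasDerivAt (fun s => ε * lseF ε (w s)) (∑ i, softmax ε (w t) i * w' i) t := by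
  have h1 : HasDerivAt (fun s => ∑ j, Real.exp (w s j / ε))
      (∑ j, Real.exp (w t j / ε) * (w' j / ε)) t :=
    HasDerivAt.fun_sum fun i _ => ((h i).div_const ε).exp
  have h2 := (h1.log (smx_sum_pos hm ε (w t)).ne').const_mul ε
  refine h2.congr_deriv (Eq.symm ?_)
  rw [Finset.sum_div, Finset.mul_sum]
  refine Finset.sum_congr rfl fun i _ => ?_
  unfold softmax
  have := (smx_sum_pos hm ε (w t)).ne'
  field_simp

section blk
variable {N : ℕ} {nAct : Fin N → ℕ}

lemma blk_mem (hn : ∀ p, 0 < nAct p) (ε : ℝ) (z : ∀ p, Fin (nAct p) → ℝ) :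
    softmaxBlk ε z ∈ simplexProd N nAct :=
  fun p => ⟨fun i => (smx_pos (hn p) ε (z p) i).le, smx_sum (hn p) ε (z p)⟩

lemma blk_coco (hn : ∀ p, 0 < nAct p) {ε : ℝ} (hε : 0 < ε) (z z' : ∀ p, Fin (nAct p) → ℝ) :
    ε * ∑ p, ∑ i, (softmaxBlk ε z p i - softmaxBlk ε z' p i) ^ 2 ≤
      ∑ p, ∑ i, (softmaxBlk ε z p i - softmaxBlk ε z' p i) * (z p i - z' p i) := by
  rw [Finset.mul_sum]
  exact Finset.sum_le_sum fun p _ => smx_coco (hn p) hε _ _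

lemma coord_le_norm (v : ∀ p, Fin (nAct p) → ℝ) (p : Fin N) (i : Fin (nAct p)) :
    |v p i| ≤ ‖v‖ :=
  (norm_le_pi_norm (v p) i).trans (norm_le_pi_norm v p)

lemma norm_sq_le (v : ∀ p, Fin (nAct p) → ℝ) : ‖v‖ ^ 2 ≤ ∑ p, ∑ i, v p i ^ 2 := by
  have h0 : 0 ≤ ∑ p, ∑ i, v p i ^ 2 :=
    Finset.sum_nonneg fun p _ => Finset.sum_nonneg fun i _ => sq_nonneg _
  rw [← Real.le_sqrt (norm_nonneg _) h0, pi_norm_le_iff_of_nonneg (Real.sqrt_nonneg _)]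
  intro p
  rw [pi_norm_le_iff_of_nonneg (Real.sqrt_nonneg _)]
  intro i
  rw [Real.norm_eq_abs]
  apply Real.abs_le_sqrt
  refine le_trans ?_ (Finset.single_le_sum (f := fun p => ∑ i, v p i ^ 2)
    (fun p _ => Finset.sum_nonneg fun i _ => sq_nonneg _) (Finset.mem_univ p))
  exact Finset.single_le_sum (f := fun i => v p i ^ 2) (fun i _ => sq_nonneg _) (Finset.mem_univ i)

lemma sum_mul_le (u v : ∀ p, Fin (nAct p) → ℝ) :
    ∑ p, ∑ i, u p i * v p i ≤ (∑ p, (nAct p : ℝ)) * (‖u‖ * ‖v‖) := by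
  have : ∀ p, ∑ i, u p i * v p i ≤ (nAct p : ℝ) * (‖u‖ * ‖v‖) := fun p => by
    calc ∑ i, u p i * v p i ≤ ∑ i : Fin (nAct p), ‖u‖ * ‖v‖ := by
          refine Finset.sum_le_sum fun i _ => ?_
          refine (le_abs_self _).trans ?_
          rw [abs_mul]
          exact mul_le_mul (coord_le_norm u p i) (coord_le_norm v p i) (abs_nonneg _) (norm_nonneg _)
      _ = _ := by simp
  rw [Finset.sum_mul]
  exact Finset.sum_le_sum fun p _ => this p

/-- existence by continuation in `lam`. -/
lemma cont_exists {μ ε : ℝ} (hμ : 0 < μ) (hεμ : μ < ε) (hn : ∀ p, 0 < nAct p)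
    (U : (∀ p, Fin (nAct p) → ℝ) → ∀ p, Fin (nAct p) → ℝ)
    (L : NNReal) (hU_lip : LipschitzOnWith L U (simplexProd N nAct))
    (hU_hypo : ∀ x ∈ simplexProd N nAct, ∀ x' ∈ simplexProd N nAct,
      ∑ p, ∑ i, (x p i - x' p i) * (U x p i - U x' p i) ≤
        μ * ∑ p, ∑ i, (x p i - x' p i) ^ 2) :
    ∃ z, U (softmaxBlk ε z) = z := by
  have hε : 0 < ε := hμ.trans hεμ
  have hd : 0 < ε - μ := sub_pos.2 hεμ
  set n : ℝ := ∑ p, (nAct p : ℝ) with hndef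
  have hn0 : 0 ≤ n := Finset.sum_nonneg fun p _ => Nat.cast_nonneg _
  -- stability estimate
  have stab : ∀ lam : ℝ, 0 ≤ lam → lam ≤ 1 → ∀ z z' y y' : ∀ p, Fin (nAct p) → ℝ,
      z = lam • U (softmaxBlk ε z) + y → z' = lam • U (softmaxBlk ε z') + y' →
      (ε - μ) * ‖softmaxBlk ε z - softmaxBlk ε z'‖ ≤ n * ‖y - y'‖ := by
    intro lam h0 h1 z z' y y' hz hz'
    have hc := blk_coco hn hε z z'
    have hm := hU_hypo _ (blk_mem hn ε z) _ (blk_mem hn ε z')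
    have hs : ∑ p, ∑ i, (softmaxBlk ε z p i - softmaxBlk ε z' p i) * (z p i - z' p i) =
        lam * ∑ p, ∑ i, (softmaxBlk ε z p i - softmaxBlk ε z' p i) *
          (U (softmaxBlk ε z) p i - U (softmaxBlk ε z') p i) +
        ∑ p, ∑ i, (softmaxBlk ε z - softmaxBlk ε z') p i * (y - y') p i := by
      rw [Finset.mul_sum, ← Finset.sum_add_distrib]
      refine Finset.sum_congr rfl fun p _ => ?_
      rw [Finset.mul_sum, ← Finset.sum_add_distrib]
      refine Finset.sum_congr rfl fun i _ => ?_
      have e1 : z p i = lam * U (softmaxBlk ε z) p i + y p i := by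
        have := congrFun (congrFun hz p) i
        simpa using this
      have e2 : z' p i = lam * U (softmaxBlk ε z') p i + y' p i := by
        have := congrFun (congrFun hz' p) i
        simpa using this
      simp only [Pi.sub_apply]
      rw [e1, e2]
      generalize U (softmaxBlk ε z) p i = a
      generalize U (softmaxBlk ε z') p i = b
      ring
    have hb := sum_mul_le (softmaxBlk ε z - softmaxBlk ε z') (y - y')
    have hq := norm_sq_le (softmaxBlk ε z - softmaxBlk ε z')
    simp only [Pi.sub_apply] at hb hq hs
    set G := ∑ p, ∑ i, (softmaxBlk ε z p i - softmaxBlk ε z' p i) ^ 2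
    have hG : 0 ≤ G := (sq_nonneg _).trans hq
    have k1 : lam * ∑ p, ∑ i, (softmaxBlk ε z p i - softmaxBlk ε z' p i) *
          (U (softmaxBlk ε z) p i - U (softmaxBlk ε z') p i) ≤ μ * G := by
      refine (mul_le_mul_of_nonneg_left hm h0).trans ?_
      have := mul_nonneg hμ.le hG
      nlinarith
    have k2 : (ε - μ) * ‖softmaxBlk ε z - softmaxBlk ε z'‖ ^ 2 ≤
        n * (‖softmaxBlk ε z - softmaxBlk ε z'‖ * ‖y - y'‖) := by
      have := mul_le_mul_of_nonneg_left hq hd.le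
      linarith
    rcases (norm_nonneg (softmaxBlk ε z - softmaxBlk ε z')).eq_or_lt with h | h
    · rw [← h, mul_zero]; positivity
    · refine le_of_mul_le_mul_right ?_ h
      linarith
  obtain ⟨M, hM⟩ := exists_nat_gt (2 * (L * (n / (ε - μ))))
  have hLn : 0 ≤ 2 * (L * (n / (ε - μ))) := by positivity
  have hM0 : (0 : ℝ) < M := hLn.trans_lt hM
  have key : ∀ k : ℕ, k ≤ M → ∀ y : ∀ p, Fin (nAct p) → ℝ,
      ∃ z, z = ((k : ℝ) / M) • U (softmaxBlk ε z) + y := by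
    intro k
    induction k with
    | zero => intro _ y; exact ⟨y, by simp⟩
    | succ k ih =>
      intro hk y
      choose Z hZ using ih (by omega)
      have hlam0 : 0 ≤ (k : ℝ) / M := by positivity
      have hlam1 : (k : ℝ) / M ≤ 1 := by
        rw [div_le_one hM0]; exact_mod_cast (by omega : k ≤ M)
      have hcontr : ContractingWith (1/2 : NNReal)
          (fun v => ((1 : ℝ) / M) • U (softmaxBlk ε (Z v)) + y) := by
        refine ⟨by rw [← NNReal.coe_lt_coe]; norm_num, LipschitzWith.of_dist_le_mul fun v v' => ?_⟩
        have h1 := stab _ hlam0 hlam1 _ _ v v' (hZ v) (hZ v')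
        have h2 := hU_lip.dist_le_mul _ (blk_mem hn ε (Z v)) _ (blk_mem hn ε (Z v'))
        rw [dist_add_right, dist_smul₀]
        rw [dist_eq_norm (softmaxBlk ε (Z v))] at h2
        rw [dist_eq_norm v]
        have h3 : ‖softmaxBlk ε (Z v) - softmaxBlk ε (Z v')‖ ≤ n / (ε - μ) * ‖v - v'‖ := by
          rw [div_mul_eq_mul_div, le_div_iff₀ hd]; linarith
        have h4 : dist (U (softmaxBlk ε (Z v))) (U (softmaxBlk ε (Z v'))) ≤
            (L * (n / (ε - μ))) * ‖v - v'‖ := by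
          refine h2.trans ?_
          rw [mul_assoc]
          exact mul_le_mul_of_nonneg_left h3 L.2
        have h5 : ‖(1 : ℝ) / M‖ = 1 / M := by
          rw [Real.norm_eq_abs, abs_of_pos]; positivity
        rw [h5]
        have h6 : (L * (n / (ε - μ))) * ‖v - v'‖ ≤ (M / 2) * ‖v - v'‖ :=
          mul_le_mul_of_nonneg_right (by linarith) (norm_nonneg _)
        have h7 : ((1 / 2 : NNReal) : ℝ) = 1 / 2 := by norm_num
        rw [h7]
        calc 1 / (M : ℝ) * _ ≤ 1 / (M : ℝ) * ((M / 2) * ‖v - v'‖) :=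
              mul_le_mul_of_nonneg_left (h4.trans h6) (by positivity)
          _ = _ := by field_simp
      have hfix := hcontr.fixedPoint_isFixedPt
      set v := ContractingWith.fixedPoint _ hcontr
      have hfix' : ((1 : ℝ) / M) • U (softmaxBlk ε (Z v)) + y = v := hfix
      refine ⟨Z v, (hZ v).trans ?_⟩
      have h8 : ∀ u v' : ∀ p, Fin (nAct p) → ℝ, ((1 : ℝ) / M) • u + y = v' →
          ((k : ℝ) / M) • u + v' = (((k + 1 : ℕ) : ℝ) / M) • u + y := by
        rintro u _ rfl
        rw [← add_assoc, ← add_smul]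
        congr 2
        push_cast
        ring
      exact h8 _ _ hfix'
  obtain ⟨z, hz⟩ := key M le_rfl 0
  refine ⟨z, ?_⟩
  rw [div_self hM0.ne', one_smul, add_zero] at hz
  exact hz.symm

end blk

/-- Theorem 1 (convergence of EXP-D-RL in hypo-monotone games): if `−U` is
`μ`-hypo-monotone on `Δ`, `U` is Lipschitz on `Δ`, `ε > μ`, and the fixed points of
`z ↦ U(σ(z))` are finitely many, then every solution of `ż = γ(U(σ(z)) − z)` on
`[0, ∞)` converges to some fixed point `z̄* = U(σ(z̄*))`, and `σ(z(t)) → σ(z̄*)`. -/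
theorem expdrl_convergence_hypo_monotone (γ μ ε : ℝ) (hγ : 0 < γ) (hμ : 0 < μ)
    (hεμ : μ < ε)
    (N : ℕ) (nAct : Fin N → ℕ) (hn : ∀ p, 0 < nAct p)
    (U : (∀ p, Fin (nAct p) → ℝ) → ∀ p, Fin (nAct p) → ℝ)
    (L : NNReal) (hU_lip : LipschitzOnWith L U (simplexProd N nAct))
    (hU_hypo : ∀ x ∈ simplexProd N nAct, ∀ x' ∈ simplexProd N nAct,
      ∑ p, ∑ i, (x p i - x' p i) * (U x p i - U x' p i) ≤
        μ * ∑ p, ∑ i, (x p i - x' p i) ^ 2)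
    (hfin : {w : ∀ p, Fin (nAct p) → ℝ | U (softmaxBlk ε w) = w}.Finite)
    (z : ℝ → ∀ p, Fin (nAct p) → ℝ)
    (hz : ∀ t, 0 ≤ t → ∀ p, ∀ i,
      HasDerivAt (fun s => z s p i) (γ * (U (softmaxBlk ε (z t)) p i - z t p i)) t) :
    ∃ zs, U (softmaxBlk ε zs) = zs ∧
      Tendsto z atTop (nhds zs) ∧
      Tendsto (fun t => softmaxBlk ε (z t)) atTop (nhds (softmaxBlk ε zs)) := by
  obtain ⟨zs, hzs⟩ := cont_exists hμ hεμ hn U L hU_lip hU_hypo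
  have hε : 0 < ε := hμ.trans hεμ
  have hd : 0 < ε - μ := sub_pos.2 hεμ
  set n : ℝ := ∑ p, (nAct p : ℝ) with hndef
  have hn0 : 0 ≤ n := Finset.sum_nonneg fun p _ => Nat.cast_nonneg _
  set K : ℝ := n * L ^ 2 / (ε - μ) with hK
  have hK0 : 0 ≤ K := by positivity
  set xs := softmaxBlk ε zs with hxs
  let e : ℝ → ℝ := fun t => ∑ p, ∑ i, (z t p i - zs p i) ^ 2
  let V : ℝ → ℝ := fun t => ∑ p, (ε * lseF ε (z t p) - ε * lseF ε (zs p)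
    - ∑ i, xs p i * (z t p i - zs p i))
  have hV0 : ∀ t, 0 ≤ V t := by
    intro t
    refine Finset.sum_nonneg fun p _ => ?_
    have := lse_conv (hn p) hε (zs p) (z t p)
    have h2 : ∑ i, softmax ε (zs p) i * (zs p i - z t p i) =
        - ∑ i, xs p i * (z t p i - zs p i) := by
      rw [← Finset.sum_neg_distrib]
      refine Finset.sum_congr rfl fun i _ => ?_
      simp only [hxs, softmaxBlk]; ring
    linarith
  have hVe : ∀ t, ε * V t ≤ e t := by
    intro t
    have h1 : V t ≤ ∑ p, ∑ i, (softmaxBlk ε (z t) p i - xs p i) * (z t p i - zs p i) := by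
      refine Finset.sum_le_sum fun p _ => ?_
      have := lse_conv (hn p) hε (z t p) (zs p)
      have h2 : ∑ i, (softmaxBlk ε (z t) p i - xs p i) * (z t p i - zs p i) =
        ∑ i, softmax ε (z t p) i * (z t p i - zs p i) - ∑ i, xs p i * (z t p i - zs p i) := by
        rw [← Finset.sum_sub_distrib]
        refine Finset.sum_congr rfl fun i _ => ?_
        simp only [softmaxBlk]; ring
      linarith
    have h2 := blk_coco hn hε (z t) zs
    have h3 : 2 * ε * ∑ p, ∑ i, (softmaxBlk ε (z t) p i - xs p i) * (z t p i - zs p i) ≤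
        ε ^ 2 * ∑ p, ∑ i, (softmaxBlk ε (z t) p i - xs p i) ^ 2 + e t := by
      simp only [e, Finset.mul_sum, ← Finset.sum_add_distrib]
      refine Finset.sum_le_sum fun p _ => Finset.sum_le_sum fun i _ => ?_
      nlinarith [sq_nonneg (ε * (softmaxBlk ε (z t) p i - xs p i) - (z t p i - zs p i))]
    have h4 := mul_le_mul_of_nonneg_left h2 hε.le
    have h5 := mul_le_mul_of_nonneg_left h1 hε.le
    nlinarith
  let De : ℝ → ℝ := fun t => ∑ p, ∑ i,
    (2 * (z t p i - zs p i) * (γ * (U (softmaxBlk ε (z t)) p i - z t p i)))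
  let DV : ℝ → ℝ := fun t => ∑ p, ∑ i,
    ((softmaxBlk ε (z t) p i - xs p i) * (γ * (U (softmaxBlk ε (z t)) p i - z t p i)))
  have hde : ∀ t, 0 ≤ t → HasDerivAt e (De t) t := by
    intro t ht
    refine HasDerivAt.fun_sum fun p _ => HasDerivAt.fun_sum fun i _ => ?_
    have := ((hz t ht p i).sub_const (zs p i)).fun_pow 2
    simpa using this
  have hdV : ∀ t, 0 ≤ t → HasDerivAt V (DV t) t := by
    intro t ht
    refine HasDerivAt.fun_sum fun p _ => ?_
    have h1 := lse_deriv (hn p) hε (fun s => z s p) _ t (hz t ht p)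
    have h2 : HasDerivAt (fun s => ∑ i, xs p i * (z s p i - zs p i))
      (∑ i, xs p i * (γ * (U (softmaxBlk ε (z t)) p i - z t p i))) t :=
      HasDerivAt.fun_sum fun i _ => ((hz t ht p i).sub_const (zs p i)).const_mul _
    have h3 := (h1.sub_const (ε * lseF ε (zs p))).fun_sub h2
    refine h3.congr_deriv (Eq.symm ?_)
    rw [← Finset.sum_sub_distrib]
    refine Finset.sum_congr rfl fun i _ => ?_
    simp only [softmaxBlk]; ring
  have hDV : ∀ t, DV t ≤ - (γ * (ε - μ)) * ∑ p, ∑ i, (softmaxBlk ε (z t) p i - xs p i) ^ 2 := by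
    intro t
    have h1 := hU_hypo _ (blk_mem hn ε (z t)) _ (blk_mem hn ε zs)
    have h2 := blk_coco hn hε (z t) zs
    rw [← hxs, hzs] at h1
    have h3 : DV t = γ * (∑ p, ∑ i, (softmaxBlk ε (z t) p i - xs p i) *
        (U (softmaxBlk ε (z t)) p i - zs p i) -
        ∑ p, ∑ i, (softmaxBlk ε (z t) p i - xs p i) * (z t p i - zs p i)) := by
      simp only [DV, Finset.mul_sum, ← Finset.sum_sub_distrib]
      refine Finset.sum_congr rfl fun p _ => Finset.sum_congr rfl fun i _ => ?_
      ring
    rw [h3]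
    rw [← hxs] at h2
    nlinarith [mul_le_mul_of_nonneg_left h1 hγ.le, mul_le_mul_of_nonneg_left h2 hγ.le]
  have hDe : ∀ t, De t ≤ γ * (n * L ^ 2 * ∑ p, ∑ i, (softmaxBlk ε (z t) p i - xs p i) ^ 2 - e t) := by
    intro t
    have h1 : De t ≤ γ * (∑ p, ∑ i, (U (softmaxBlk ε (z t)) p i - zs p i) ^ 2 - e t) := by
      simp only [De, e, Finset.mul_sum, ← Finset.sum_sub_distrib]
      refine Finset.sum_le_sum fun p _ => Finset.sum_le_sum fun i _ => ?_
      have := mul_nonneg hγ.le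
        (sq_nonneg ((U (softmaxBlk ε (z t)) p i - zs p i) - (z t p i - zs p i)))
      nlinarith
    have h2 := hU_lip.dist_le_mul _ (blk_mem hn ε (z t)) _ (blk_mem hn ε zs)
    rw [← hxs, hzs, dist_eq_norm, dist_eq_norm] at h2
    have h3 := sum_mul_le (U (softmaxBlk ε (z t)) - zs) (U (softmaxBlk ε (z t)) - zs)
    have h4 := norm_sq_le (softmaxBlk ε (z t) - xs)
    simp only [Pi.sub_apply, ← pow_two] at h3 h4
    have h5 := pow_le_pow_left₀ (norm_nonneg _) h2 2
    rw [mul_pow] at h5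
    have h6 := mul_le_mul_of_nonneg_left h5 hn0
    have h7 := mul_le_mul_of_nonneg_left h4 (by positivity : 0 ≤ n * (L : ℝ) ^ 2)
    refine h1.trans (mul_le_mul_of_nonneg_left ?_ hγ.le)
    linarith
  have hE : ∀ t, De t + K * DV t ≤ - γ * e t := by
    intro t
    have h1 := hDe t
    have h2 := mul_le_mul_of_nonneg_left (hDV t) hK0
    have h3 : K * (ε - μ) = n * L ^ 2 := by rw [hK]; field_simp
    have h4 : K * (-(γ * (ε - μ)) * ∑ p, ∑ i, (softmaxBlk ε (z t) p i - xs p i) ^ 2) =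
      - γ * (n * L ^ 2) * ∑ p, ∑ i, (softmaxBlk ε (z t) p i - xs p i) ^ 2 := by
      rw [← h3]; ring
    rw [h4] at h2
    linarith
  set c : ℝ := γ / (1 + K / ε) with hc
  have hc1 : 0 < 1 + K / ε := by positivity
  have hc0 : 0 < c := by positivity
  have hcE : ∀ t, c * (e t + K * V t) ≤ γ * e t := by
    intro t
    have h1 : K * V t ≤ K / ε * e t := by
      have := mul_le_mul_of_nonneg_left (hVe t) (by positivity : 0 ≤ K / ε)
      have h2 : K / ε * (ε * V t) = K * V t := by field_simp
      linarith
    calc c * (e t + K * V t) ≤ c * ((1 + K / ε) * e t) :=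
          mul_le_mul_of_nonneg_left (by linarith) hc0.le
      _ = γ * e t := by rw [hc]; field_simp
  have hder : ∀ t, 0 ≤ t → HasDerivAt (fun s => (e s + K * V s) * Real.exp (c * s))
      ((De t + K * DV t) * Real.exp (c * t) + (e t + K * V t) * (Real.exp (c * t) * c)) t := by
    intro t ht
    have h1 : HasDerivAt (fun s => Real.exp (c * s)) (Real.exp (c * t) * c) t := by
      simpa using ((hasDerivAt_id t).const_mul c).exp
    exact ((hde t ht).fun_add ((hdV t ht).const_mul K)).fun_mul h1
  have hanti : AntitoneOn (fun s => (e s + K * V s) * Real.exp (c * s)) (Set.Ici 0) := by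
    refine antitoneOn_of_hasDerivWithinAt_nonpos (convex_Ici 0)
      (fun t ht => (hder t ht).continuousAt.continuousWithinAt)
      (fun t ht => (hder t (interior_subset ht)).hasDerivWithinAt) ?_
    intro t ht
    have h1 := hE t
    have h2 := hcE t
    have h3 := Real.exp_pos (c * t)
    have : (De t + K * DV t) + c * (e t + K * V t) ≤ 0 := by linarith
    nlinarith [mul_nonneg_of_nonpos_of_nonpos this (neg_nonpos.2 h3.le)]
  have hebound : ∀ t, 0 ≤ t → e t ≤ (e 0 + K * V 0) * Real.exp (-(c * t)) := by
    intro t ht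
    have h1 := hanti (Set.mem_Ici.2 le_rfl) (Set.mem_Ici.2 ht) ht
    simp only [mul_zero, Real.exp_zero, mul_one] at h1
    rw [Real.exp_neg, ← div_eq_mul_inv, le_div_iff₀ (Real.exp_pos _)]
    have := mul_nonneg hK0 (hV0 t)
    nlinarith [Real.exp_pos (c * t)]
  have helim : Tendsto e atTop (nhds 0) := by
    have h1 : Tendsto (fun t => (e 0 + K * V 0) * Real.exp (-(c * t))) atTop (nhds 0) := by
      have : Tendsto (fun t => Real.exp (-(c * t))) atTop (nhds 0) :=
        Real.tendsto_exp_neg_atTop_nhds_zero.comp (tendsto_id.const_mul_atTop hc0)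
      simpa using this.const_mul (e 0 + K * V 0)
    refine squeeze_zero' (Eventually.of_forall fun t => ?_) ?_ h1
    · exact Finset.sum_nonneg fun p _ => Finset.sum_nonneg fun i _ => sq_nonneg _
    · filter_upwards [eventually_ge_atTop 0] with t ht using hebound t ht
  have hzlim : Tendsto z atTop (nhds zs) := by
    rw [tendsto_iff_norm_sub_tendsto_zero]
    have h1 : Tendsto (fun t => Real.sqrt (e t)) atTop (nhds 0) := by
      simpa using helim.sqrt
    refine squeeze_zero (fun t => norm_nonneg _) (fun t => ?_) h1
    exact Real.le_sqrt_of_sq_le (by simpa using norm_sq_le (z t - zs))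
  refine ⟨zs, hzs, hzlim, ?_⟩
  have hcont : Continuous (fun w : ∀ p, Fin (nAct p) → ℝ => softmaxBlk ε w) := by
    refine continuous_pi fun p => continuous_pi fun i => ?_
    unfold softmaxBlk softmax
    refine Continuous.div (by fun_prop) (by fun_prop) fun w => (smx_sum_pos (hn p) ε (w p)).ne'
  exact (hcont.tendsto zs).comp hzlim
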